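/- arXiv:1112.5073 — 3 statements merged into one kernel-verified Lean document; each statement's English description precedes it below -/
import Mathlib

section
/- Let S be an even lattice of signature (s₊, s₋), and let l₊, l₋ be nonnegative integers. Then there exists an even unimodular lattice L of signature (l₊, l₋) together with a primitive embedding of S into L if and only if there exists an even lattice M of signature (l₊ − s₊, l₋ − s₋) together with a group isomorphism A_M ≅ A_S carrying the discriminant form q_M to −q_S. -/
open Matrix

/-!
Nikulin's criterion for the existence of a primitive embedding of an even
lattice into some even unimodular lattice of prescribed signature.

Lattices are modelled by their Gram matrices.
-/

/-- The bilinear form of the lattice with Gram matrix `B`. -/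
def latForm {n : ℕ} (B : Matrix (Fin n) (Fin n) ℤ) (x y : Fin n → ℤ) : ℤ :=
  x ⬝ᵥ B.mulVec y

/-- `B` is the Gram matrix of an even lattice: symmetric, nondegenerate,
with even squares. -/
def IsEvenLattice {n : ℕ} (B : Matrix (Fin n) (Fin n) ℤ) : Prop :=
  B.IsSymm ∧ B.det ≠ 0 ∧ ∀ i, 2 ∣ B i i

/-- The lattice with Gram matrix `B` has signature `(p, q)`. -/
def HasSignature {n : ℕ} (B : Matrix (Fin n) (Fin n) ℤ) (p q : ℕ) : Prop :=
  p + q = n ∧ ∃ P : Matrix (Fin n) (Fin n) ℝ, IsUnit P.det ∧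
    Pᵀ * B.map (Int.cast : ℤ → ℝ) * P =
      Matrix.diagonal (fun i : Fin n => if (i : ℕ) < p then (1 : ℝ) else -1)

/-- `f` is a primitive embedding of the lattice with Gram matrix `BS` into the
lattice with Gram matrix `BL`: an injective isometry with torsion-free
cokernel. -/
def IsPrimitiveEmbedding {k n : ℕ} (BS : Matrix (Fin k) (Fin k) ℤ)
    (BL : Matrix (Fin n) (Fin n) ℤ) (f : (Fin k → ℤ) →ₗ[ℤ] (Fin n → ℤ)) : Prop :=
  Function.Injective f ∧
  (∀ x y, latForm BL (f x) (f y) = latForm BS x y) ∧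
  (∀ (x : Fin n → ℤ) (c : ℤ), c ≠ 0 → c • x ∈ LinearMap.range f →
    x ∈ LinearMap.range f)

/-- The discriminant group `A_B = L^∨/L`, realized as the cokernel of
`B : ℤⁿ → ℤⁿ`. -/
abbrev DiscGroup {n : ℕ} (B : Matrix (Fin n) (Fin n) ℤ) :=
  (Fin n → ℤ) ⧸ LinearMap.range (Matrix.toLin' B)

/-- The class of an integer vector in the discriminant group. -/
def discMk {n : ℕ} (B : Matrix (Fin n) (Fin n) ℤ) (v : Fin n → ℤ) : DiscGroup B :=
  Submodule.Quotient.mk v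

/-- A rational number representing the value of the discriminant quadratic form
(with values in `ℚ/2ℤ`) at the class of `v`, namely `vᵀ B⁻¹ v`. -/
noncomputable def qVal {n : ℕ} (B : Matrix (Fin n) (Fin n) ℤ) (v : Fin n → ℤ) : ℚ :=
  (fun i => (v i : ℚ)) ⬝ᵥ ((B.map (Int.cast : ℤ → ℚ))⁻¹).mulVec (fun i => (v i : ℚ))

/-- A real matrix `A` is congruent to a diagonal matrix with `p` positive, `q` negative and no
zero entries. -/
def HasRealSignature {ι : Type*} [Fintype ι] [DecidableEq ι] (A : Matrix ι ι ℝ) (p q : ℕ) : Prop :=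
  ∃ (P : Matrix ι ι ℝ) (w : ι → ℝ), (∀ i, w i ≠ 0) ∧ Pᵀ * A * P = diagonal w ∧
    {i | 0 < w i}.ncard = p ∧ {i | w i < 0}.ncard = q

namespace HasRealSignature

variable {ι κ : Type*} [Fintype ι] [DecidableEq ι] [Fintype κ] [DecidableEq κ]

theorem isUnit_det_of_congr_diagonal {A P : Matrix ι ι ℝ} {w : ι → ℝ} (hw : ∀ i, w i ≠ 0)
    (h : Pᵀ * A * P = diagonal w) : IsUnit P.det := by
  have h' := congrArg det h
  rw [det_mul, det_diagonal] at h'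
  refine isUnit_iff_ne_zero.2 fun h0 => ?_
  rw [h0, mul_zero] at h'
  exact Finset.prod_ne_zero_iff.2 (fun i _ => hw i) h'.symm

theorem eq_sigPos_sigNeg {A : Matrix ι ι ℝ} {p q : ℕ} (h : HasRealSignature A p q) :
    p = sigPos A.toQuadraticForm' ∧
      q = sigNeg A.toQuadraticForm' := by
  obtain ⟨P, w, hw, hP, rfl, rfl⟩ := h
  have hu := isUnit_det_of_congr_diagonal hw hP
  have heq : QuadraticMap.Equivalent A.toQuadraticForm'
      (QuadraticMap.weightedSumSquares ℝ w) := by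
    refine QuadraticMap.Equivalent.symm
      ⟨⟨Matrix.toLin'OfInv (P.nonsing_inv_mul hu) (P.mul_nonsing_inv hu), fun v => ?_⟩⟩
    have h1 : v ⬝ᵥ (Pᵀ * A * P) *ᵥ v = v ⬝ᵥ (diagonal w) *ᵥ v := by rw [hP]
    rw [← mulVec_mulVec, ← mulVec_mulVec, mulVec_transpose, dotProduct_comm,
      ← dotProduct_mulVec, dotProduct_comm] at h1
    simp only [QuadraticMap.weightedSumSquares_apply, Matrix.toQuadraticForm',
      LinearMap.BilinMap.toQuadraticMap_apply, Matrix.toLinearMap₂'_apply']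
    refine Eq.trans ?_ (h1.trans ?_)
    · rfl
    · simp only [dotProduct, mulVec_diagonal, smul_eq_mul]
      exact Finset.sum_congr rfl fun i _ => by ring
  exact ⟨(QuadraticForm.sigPos_of_equiv_weightedSumSquares heq).symm,
    (QuadraticForm.sigNeg_of_equiv_weightedSumSquares heq).symm⟩

theorem unique {A : Matrix ι ι ℝ} {p q p' q' : ℕ} (h : HasRealSignature A p q)
    (h' : HasRealSignature A p' q') : p = p' ∧ q = q' :=
  ⟨h.eq_sigPos_sigNeg.1.trans h'.eq_sigPos_sigNeg.1.symm,
    h.eq_sigPos_sigNeg.2.trans h'.eq_sigPos_sigNeg.2.symm⟩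

theorem add_eq_card {A : Matrix ι ι ℝ} {p q : ℕ} (h : HasRealSignature A p q) :
    p + q = Fintype.card ι := by
  obtain ⟨P, w, hw, -, rfl, rfl⟩ := h
  rw [← Set.ncard_union_eq, ← Nat.card_eq_fintype_card, ← Set.ncard_univ]
  · congr 1
    ext i
    simpa [or_comm] using lt_or_gt_of_ne (hw i)
  · exact Set.disjoint_left.2 fun i (h1 : 0 < w i) (h2 : w i < 0) => lt_asymm h1 h2

theorem exists_of_det_ne_zero {A : Matrix ι ι ℝ} (hA : A.IsSymm) (hdet : A.det ≠ 0) :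
    ∃ p q, HasRealSignature A p q := by
  have hH : A.IsHermitian := by rwa [IsHermitian, conjTranspose_eq_transpose_of_trivial]
  have h := hH.conjStarAlgAut_star_eigenvectorUnitary
  rw [Unitary.conjStarAlgAut_star_apply] at h
  refine ⟨_, _, (hH.eigenvectorUnitary : Matrix ι ι ℝ), hH.eigenvalues, fun i h0 => hdet ?_,
    ?_, rfl, rfl⟩
  · rw [hH.det_eq_prod_eigenvalues]
    exact Finset.prod_eq_zero (Finset.mem_univ i) (by simpa using h0)
  · simpa [star_eq_conjTranspose, conjTranspose_eq_transpose_of_trivial] using h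

theorem of_congr {A : Matrix ι ι ℝ} {D : Matrix κ κ ℝ} {H : Matrix ι κ ℝ}
    (hcard : Fintype.card ι = Fintype.card κ) (hH : Hᵀ * A * H = D) {p q : ℕ}
    (h : HasRealSignature D p q) : HasRealSignature A p q := by
  obtain ⟨P, w, hw, hP, rfl, rfl⟩ := h
  let σ : ι ≃ κ := Fintype.equivOfCardEq hcard
  refine ⟨(H * P).submatrix id σ, w ∘ σ, fun i => hw _, ?_, ?_, ?_⟩
  · have h : Pᵀ * (Hᵀ * A * H) * P = (H * P)ᵀ * A * (H * P) := by
      simp only [transpose_mul, Matrix.mul_assoc]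
    rw [← submatrix_diagonal_equiv, ← hP, ← hH, h]
    ext i j
    simp [Matrix.mul_apply]
  · exact Set.ncard_preimage_of_injective_subset_range (s := {i | 0 < w i}) σ.injective
      (by simp)
  · exact Set.ncard_preimage_of_injective_subset_range (s := {i | w i < 0}) σ.injective
      (by simp)

theorem fromBlocks {A : Matrix ι ι ℝ} {B : Matrix κ κ ℝ} {p q p' q' : ℕ}
    (hA : HasRealSignature A p q) (hB : HasRealSignature B p' q') :
    HasRealSignature (Matrix.fromBlocks A 0 0 B) (p + p') (q + q') := by
  obtain ⟨P, w, hw, hP, rfl, rfl⟩ := hA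
  obtain ⟨P', w', hw', hP', rfl, rfl⟩ := hB
  have hcount (T : Set ℝ) : {i | Sum.elim w w' i ∈ T}.ncard =
      {i | w i ∈ T}.ncard + {i | w' i ∈ T}.ncard := by
    have : {i | Sum.elim w w' i ∈ T} = Sum.inl '' {i | w i ∈ T} ∪ Sum.inr '' {i | w' i ∈ T} := by
      ext (i | i) <;> simp
    rw [this, Set.ncard_union_eq, Set.ncard_image_of_injective _ Sum.inl_injective,
      Set.ncard_image_of_injective _ Sum.inr_injective]
    exact Set.disjoint_left.2 (by rintro _ ⟨i, -, rfl⟩ ⟨j, -, h⟩; cases h)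
  refine ⟨Matrix.fromBlocks P 0 0 P', Sum.elim w w', ?_, ?_, hcount (Set.Ioi 0),
    hcount (Set.Iio 0)⟩
  · rintro (i | i)
    exacts [hw i, hw' i]
  · simp [fromBlocks_transpose, fromBlocks_multiply, hP, hP', ← fromBlocks_diagonal]

end HasRealSignature

theorem ncard_fin_lt {n p : ℕ} (h : p ≤ n) : {i : Fin n | (i : ℕ) < p}.ncard = p := by
  rw [← Set.ncard_image_of_injective _ Fin.val_injective]
  have : Fin.val '' {i : Fin n | (i : ℕ) < p} = ((Finset.range p : Finset ℕ) : Set ℕ) := by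
    ext x
    simp only [Set.mem_image, Set.mem_ofPred_eq, Finset.coe_range, Set.mem_Iio]
    exact ⟨by rintro ⟨i, hi, rfl⟩; exact hi, fun hx => ⟨⟨x, hx.trans_le h⟩, hx, rfl⟩⟩
  rw [this, Set.ncard_coe_finset, Finset.card_range]

theorem HasSignature.hasRealSignature {n : ℕ} {B : Matrix (Fin n) (Fin n) ℤ} {p q : ℕ}
    (h : HasSignature B p q) :
    HasRealSignature (B.map (Int.cast : ℤ → ℝ)) p q := by
  obtain ⟨hn, P, -, hP⟩ := h
  have hp : {i : Fin n | 0 < (if (i : ℕ) < p then (1 : ℝ) else -1)}.ncard = p := by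
    convert ncard_fin_lt (show p ≤ n by lia) using 4 with i
    split_ifs <;> simp [*]
  have hw : ∀ i : Fin n, (if (i : ℕ) < p then (1 : ℝ) else -1) ≠ 0 := fun i => by
    split_ifs <;> norm_num
  have h' : HasRealSignature (B.map (Int.cast : ℤ → ℝ)) p _ := ⟨P, _, hw, hP, hp, rfl⟩
  have := h'.add_eq_card
  rw [Fintype.card_fin] at this
  have hq : {i : Fin n | (if (i : ℕ) < p then (1 : ℝ) else -1) < 0}.ncard = q := by lia
  rwa [hq] at h'

theorem HasRealSignature.hasSignature {n : ℕ} {B : Matrix (Fin n) (Fin n) ℤ} {p q : ℕ}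
    (h : HasRealSignature (B.map (Int.cast : ℤ → ℝ)) p q) : HasSignature B p q := by
  have hn := h.add_eq_card
  rw [Fintype.card_fin] at hn
  obtain ⟨P, w, hw, hP, hp, -⟩ := h
  refine ⟨hn, ?_⟩
  obtain ⟨σ, hσ⟩ : ∃ σ : Equiv.Perm (Fin n), ∀ i : Fin n, (i : ℕ) < p ↔ 0 < w (σ i) := by
    have hc : Fintype.card {i : Fin n // (i : ℕ) < p} = Fintype.card {i : Fin n // 0 < w i} := by
      rw [← Nat.card_eq_fintype_card, ← Nat.card_eq_fintype_card]
      exact (ncard_fin_lt (show p ≤ n by lia)).trans hp.symm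
    let e := Fintype.equivOfCardEq hc
    exact ⟨e.extendSubtype, fun i => ⟨fun hi => e.extendSubtype_mem i hi,
      fun hi => by_contra fun h => e.extendSubtype_not_mem i h hi⟩⟩
  let Q : Matrix (Fin n) (Fin n) ℝ :=
    P.submatrix id σ * diagonal fun i => (√|w (σ i)|)⁻¹
  have hQ : Qᵀ * B.map (Int.cast : ℤ → ℝ) * Q =
      diagonal (fun i : Fin n => if (i : ℕ) < p then (1 : ℝ) else -1) := by
    have h1 : (P.submatrix id σ)ᵀ * B.map (Int.cast : ℤ → ℝ) * P.submatrix id σ =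
        diagonal (w ∘ σ) := by
      rw [← submatrix_diagonal_equiv, ← hP]
      ext i j
      simp [Matrix.mul_apply]
    have h2 : Qᵀ * B.map (Int.cast : ℤ → ℝ) * Q = (diagonal fun i => (√|w (σ i)|)⁻¹) *
        ((P.submatrix id σ)ᵀ * B.map (Int.cast : ℤ → ℝ) * P.submatrix id σ) *
        (diagonal fun i => (√|w (σ i)|)⁻¹) := by
      simp only [Q, transpose_mul, diagonal_transpose, Matrix.mul_assoc]
    rw [h2, h1, diagonal_mul_diagonal, diagonal_mul_diagonal]
    congr 1
    ext i
    have hs : √|w (σ i)| * √|w (σ i)| = |w (σ i)| := Real.mul_self_sqrt (abs_nonneg _)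
    have hs0 : √|w (σ i)| ≠ 0 := (Real.sqrt_pos.2 (abs_pos.2 (hw _))).ne'
    have hσi := hσ i
    simp only [Function.comp_apply]
    split_ifs with hi
    · rw [abs_of_pos (hσi.1 hi)] at hs hs0 ⊢
      field_simp
      linarith
    · rw [abs_of_neg (lt_of_le_of_ne (not_lt.1 fun h => hi (hσi.2 h)) (hw _))] at hs hs0 ⊢
      field_simp
      linarith
  exact ⟨Q, HasRealSignature.isUnit_det_of_congr_diagonal
    (fun i => by split_ifs <;> norm_num) hQ, hQ⟩

section IntegralMatrices

variable {ι κ μ : Type*}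

/-- An integer vector, viewed as a rational vector. -/
def ratVec (v : ι → ℤ) : ι → ℚ := fun i => (v i : ℚ)

/-- An integer matrix, viewed as a rational matrix. -/
def ratMat (A : Matrix ι κ ℤ) : Matrix ι κ ℚ := A.map (Int.cast : ℤ → ℚ)

theorem ratMat_mul [Fintype κ] (A : Matrix ι κ ℤ) (B : Matrix κ μ ℤ) :
    ratMat (A * B) = ratMat A * ratMat B :=
  Matrix.map_mul (f := Int.castRingHom ℚ)

theorem ratMat_transpose (A : Matrix ι κ ℤ) : ratMat Aᵀ = (ratMat A)ᵀ := rfl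

theorem ratVec_mulVec [Fintype κ] (A : Matrix ι κ ℤ) (v : κ → ℤ) :
    ratVec (A *ᵥ v) = ratMat A *ᵥ ratVec v :=
  funext fun i => RingHom.map_mulVec (Int.castRingHom ℚ) A v i

theorem ratVec_dotProduct [Fintype ι] (v w : ι → ℤ) : ((v ⬝ᵥ w : ℤ) : ℚ) = ratVec v ⬝ᵥ ratVec w :=
  RingHom.map_dotProduct (Int.castRingHom ℚ) v w

theorem ratVec_injective : Function.Injective (ratVec : (ι → ℤ) → ι → ℚ) :=
  fun _ _ h => funext fun i => Int.cast_injective (congrFun h i)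

theorem ratMat_injective : Function.Injective (ratMat : Matrix ι κ ℤ → Matrix ι κ ℚ) :=
  fun A B h => by
    ext i j
    exact Int.cast_injective (congrFun (congrFun h i) j)

theorem det_ratMat [Fintype ι] [DecidableEq ι] (A : Matrix ι ι ℤ) : (ratMat A).det = (A.det : ℚ) :=
  (Int.castRingHom ℚ).map_det A |>.symm

theorem isUnit_det_ratMat [Fintype ι] [DecidableEq ι] {A : Matrix ι ι ℤ} (h : A.det ≠ 0) : IsUnit (ratMat A).det := by
  rw [det_ratMat]
  exact isUnit_iff_ne_zero.2 (by exact_mod_cast h)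

theorem transpose_mulVec_dotProduct [Fintype ι] [Fintype κ] {R : Type*} [CommRing R] (A : Matrix ι κ R)
    (x : ι → R) (y : κ → R) : Aᵀ *ᵥ x ⬝ᵥ y = x ⬝ᵥ A *ᵥ y := by
  rw [mulVec_transpose, ← dotProduct_mulVec]

theorem mulVec_eq_zero_of_det_ne_zero [Fintype ι] [DecidableEq ι] {A : Matrix ι ι ℤ} (h : A.det ≠ 0) {x : ι → ℤ}
    (hx : A *ᵥ x = 0) : x = 0 := by
  by_contra h0
  exact h (exists_mulVec_eq_zero_iff.1 ⟨x, h0, hx⟩)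

theorem even_dotProduct_mulVec {n : ℕ} {A : Matrix (Fin n) (Fin n) ℤ} (hA : A.IsSymm)
    (hdiag : ∀ i, 2 ∣ A i i) (x : Fin n → ℤ) : 2 ∣ x ⬝ᵥ A *ᵥ x := by
  let U : Matrix (Fin n) (Fin n) ℤ :=
    Matrix.of fun i j => if i < j then A i j else if i = j then A i j / 2 else 0
  have hU : A = U + Uᵀ := by
    ext i j
    have h1 := hdiag i
    have h2 := hA.apply i j
    simp only [U, Matrix.add_apply, transpose_apply, of_apply]
    rcases lt_trichotomy i j with h | rfl | h
    · simp [h, h.not_gt, h.ne']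
    · simp only [lt_irrefl, if_true, if_false]
      lia
    · simp [h, h.not_gt, h.ne', h2]
  refine ⟨x ⬝ᵥ U *ᵥ x, ?_⟩
  have h3 : x ⬝ᵥ Uᵀ *ᵥ x = x ⬝ᵥ U *ᵥ x := by
    rw [dotProduct_comm, transpose_mulVec_dotProduct]
  rw [hU, add_mulVec, dotProduct_add, h3]
  ring

theorem exists_leftInverse_of_saturated [Finite ι] {f : (κ → ℤ) →ₗ[ℤ] (ι → ℤ)}
    (hf : Function.Injective f)
    (hsat : ∀ (x : ι → ℤ) (c : ℤ), c ≠ 0 → c • x ∈ LinearMap.range f → x ∈ LinearMap.range f) :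
    ∃ g : (ι → ℤ) →ₗ[ℤ] (κ → ℤ), ∀ x, g (f x) = x := by
  have : Module.IsTorsionFree ℤ ((ι → ℤ) ⧸ LinearMap.range f) := by
    refine Module.isTorsionFree_iff_smul_eq_zero.2 fun c x => ?_
    obtain ⟨x, rfl⟩ := Submodule.mkQ_surjective _ x
    rw [← map_smul, Submodule.mkQ_apply, Submodule.mkQ_apply, Submodule.Quotient.mk_eq_zero,
      Submodule.Quotient.mk_eq_zero]
    exact fun h => or_iff_not_imp_left.2 fun hc => hsat x c hc h
  obtain ⟨s, hs⟩ := Module.projective_lifting_property (LinearMap.range f).mkQ LinearMap.id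
    (Submodule.mkQ_surjective _)
  let r : (ι → ℤ) →ₗ[ℤ] (ι → ℤ) := LinearMap.id - s ∘ₗ (LinearMap.range f).mkQ
  have hmem : ∀ x, r x ∈ LinearMap.range f := by
    intro x
    have h := LinearMap.congr_fun hs ((LinearMap.range f).mkQ x)
    rw [← Submodule.Quotient.mk_eq_zero, ← Submodule.mkQ_apply]
    simp only [LinearMap.comp_apply, LinearMap.id_apply] at h
    simp [r, LinearMap.sub_apply, h, - Submodule.mkQ_apply]
  let e := LinearEquiv.ofInjective f hf
  refine ⟨e.symm.toLinearMap ∘ₗ LinearMap.codRestrict _ r hmem, fun x => ?_⟩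
  rw [LinearMap.comp_apply, LinearEquiv.coe_coe, LinearEquiv.symm_apply_eq]
  apply Subtype.ext
  have h0 : (LinearMap.range f).mkQ (f x) = 0 := by simp
  simp [e, r, h0, - Submodule.mkQ_apply]

theorem transpose_mulVec_surjective_of_saturated [Fintype ι] [Fintype κ] {F : Matrix ι κ ℤ}
    (hF : Function.Injective F.mulVec)
    (hsat : ∀ (x : ι → ℤ) (c : ℤ), c ≠ 0 → (∃ y, F *ᵥ y = c • x) → ∃ y, F *ᵥ y = x)
    (z : κ → ℤ) : ∃ x, Fᵀ *ᵥ x = z := by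
  classical
  obtain ⟨g, hg⟩ := exists_leftInverse_of_saturated (f := F.mulVecLin) hF
    (fun x c hc h => hsat x c hc h)
  have h : LinearMap.toMatrix' g * F = 1 := by
    refine Matrix.toLin'.injective (LinearMap.ext fun x => ?_)
    rw [Matrix.toLin'_mul, Matrix.toLin'_toMatrix', Matrix.toLin'_one]
    exact hg x
  refine ⟨(LinearMap.toMatrix' g)ᵀ *ᵥ z, ?_⟩
  rw [mulVec_mulVec, ← transpose_mul, h, transpose_one, one_mulVec]

end IntegralMatrices

theorem fromBlocks_det_ne_zero {k m : ℕ} {BS : Matrix (Fin k) (Fin k) ℤ}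
    {BM : Matrix (Fin m) (Fin m) ℤ} (hS : BS.det ≠ 0) (hM : BM.det ≠ 0) :
    (fromBlocks BS 0 0 BM).det ≠ 0 := by
  rw [det_fromBlocks_zero₂₁]
  exact mul_ne_zero hS hM

theorem qVal_add_qVal {k m : ℕ} {BS : Matrix (Fin k) (Fin k) ℤ}
    {BM : Matrix (Fin m) (Fin m) ℤ} (hS : BS.det ≠ 0) (hM : BM.det ≠ 0)
    (v : Fin m → ℤ) (w : Fin k → ℤ) :
    qVal BM v + qVal BS w = ratVec (Sum.elim w v) ⬝ᵥ
      (ratMat (fromBlocks BS 0 0 BM))⁻¹ *ᵥ ratVec (Sum.elim w v) := by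
  have h1 : (ratMat (fromBlocks BS 0 0 BM))⁻¹ =
      fromBlocks (ratMat BS)⁻¹ 0 0 (ratMat BM)⁻¹ := by
    refine inv_eq_right_inv ?_
    have h2 : ratMat (fromBlocks BS 0 0 BM) = fromBlocks (ratMat BS) 0 0 (ratMat BM) := by
      simp [ratMat, fromBlocks_map]
    simp [h2, fromBlocks_multiply, mul_nonsing_inv _ (isUnit_det_ratMat hS),
      mul_nonsing_inv _ (isUnit_det_ratMat hM)]
  have h3 : ratVec (Sum.elim w v) = Sum.elim (ratVec w) (ratVec v) := by
    ext (i | i) <;> rfl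
  rw [h1, h3, fromBlocks_mulVec]
  simp [sumElim_dotProduct_sumElim, qVal, add_comm, ratMat]
  rfl

section OrthogonalComplement

variable {k m n : ℕ}

theorem exists_basis_orthogonal {A : Matrix (Fin n) (Fin n) ℤ} (hA : IsUnit A.det)
    {F : Matrix (Fin n) (Fin k) ℤ} (hF : ∀ z, ∃ x, Fᵀ *ᵥ x = z) :
    ∃ (m : ℕ) (G : Matrix (Fin n) (Fin m) ℤ), k + m = n ∧ Function.Injective G.mulVec ∧
      ∀ x, Fᵀ *ᵥ A *ᵥ x = 0 ↔ ∃ y, G *ᵥ y = x := by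
  let φ : (Fin n → ℤ) →ₗ[ℤ] (Fin k → ℤ) := Fᵀ.mulVecLin ∘ₗ A.mulVecLin
  have hφ : Function.Surjective φ := by
    intro z
    obtain ⟨x, rfl⟩ := hF z
    exact ⟨A⁻¹ *ᵥ x, by
      simp only [φ, LinearMap.comp_apply, mulVecLin_apply, mulVec_mulVec, mul_nonsing_inv _ hA,
        Matrix.mul_one]⟩
  let b := Module.finBasis ℤ (LinearMap.ker φ)
  let g : (Fin (Module.finrank ℤ (LinearMap.ker φ)) → ℤ) →ₗ[ℤ] (Fin n → ℤ) :=
    (LinearMap.ker φ).subtype ∘ₗ b.equivFun.symm.toLinearMap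
  have hg : ∀ y, LinearMap.toMatrix' g *ᵥ y = g y := fun y => LinearMap.toMatrix'_mulVec g y
  refine ⟨_, LinearMap.toMatrix' g, ?_, ?_, fun x => ?_⟩
  · have h := (LinearMap.ker φ).finrank_quotient_add_finrank
    rw [(φ.quotKerEquivOfSurjective hφ).finrank_eq] at h
    simpa using h
  · intro x y h
    simp only [hg] at h
    exact b.equivFun.symm.injective (Subtype.val_injective h)
  · simp only [hg]
    refine ⟨fun h => ⟨b.equivFun ⟨x, h⟩, by simp [g]⟩, ?_⟩
    rintro ⟨y, rfl⟩
    exact (b.equivFun.symm y).2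

variable {A : Matrix (Fin n) (Fin n) ℤ} {F : Matrix (Fin n) (Fin k) ℤ}
  {G : Matrix (Fin n) (Fin m) ℤ}

theorem transpose_mul_mul_eq_zero_of_orthogonal
    (hG : ∀ x, Fᵀ *ᵥ A *ᵥ x = 0 ↔ ∃ y, G *ᵥ y = x) : Fᵀ * A * G = 0 := by
  refine Matrix.toLin'.injective (LinearMap.ext fun y => ?_)
  simpa using (hG (G *ᵥ y)).2 ⟨y, rfl⟩

theorem transpose_mul_mul_eq_zero_symm (hA : A.IsSymm) (h : Fᵀ * A * G = 0) :
    Gᵀ * A * F = 0 := by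
  have h' := congrArg transpose h
  rwa [transpose_mul, transpose_mul, transpose_transpose, hA.eq, ← Matrix.mul_assoc,
    transpose_zero] at h'

theorem exists_smul_eq_add_of_orthogonal
    (hG : ∀ x, Fᵀ *ᵥ A *ᵥ x = 0 ↔ ∃ y, G *ᵥ y = x) (x : Fin n → ℤ) :
    ∃ s t, (Fᵀ * A * F).det • x = F *ᵥ s + G *ᵥ t := by
  set B := Fᵀ * A * F with hB
  let s := B.adjugate *ᵥ Fᵀ *ᵥ A *ᵥ x
  obtain ⟨t, ht⟩ := (hG (B.det • x - F *ᵥ s)).1 (by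
    rw [mulVec_sub, mulVec_sub, mulVec_smul, mulVec_smul, sub_eq_zero]
    have h : Fᵀ *ᵥ A *ᵥ F *ᵥ s = B *ᵥ s := by simp [hB, Matrix.mul_assoc]
    rw [h]
    rw [show B *ᵥ s = (B * B.adjugate) *ᵥ Fᵀ *ᵥ A *ᵥ x from mulVec_mulVec _ _ _, mul_adjugate, smul_mulVec, one_mulVec])
  exact ⟨s, t, by rw [ht]; abel⟩

theorem det_orthogonal_ne_zero (hAu : IsUnit A.det)
    (hF : (Fᵀ * A * F).det ≠ 0) (hGinj : Function.Injective G.mulVec)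
    (hG : ∀ x, Fᵀ *ᵥ A *ᵥ x = 0 ↔ ∃ y, G *ᵥ y = x) : (Gᵀ * A * G).det ≠ 0 := by
  intro h0
  obtain ⟨t, ht, ht0⟩ := exists_mulVec_eq_zero_iff.2 h0
  refine ht (hGinj ?_)
  have h1 : A *ᵥ G *ᵥ t = 0 := by
    refine dotProduct_eq_zero _ fun x => ?_
    obtain ⟨s, t', hx⟩ := exists_smul_eq_add_of_orthogonal hG x
    have h2 : (Fᵀ * A * F).det • (A *ᵥ G *ᵥ t ⬝ᵥ x) = 0 := by
      rw [← dotProduct_smul, hx, dotProduct_add, ← transpose_mulVec_dotProduct,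
        ← transpose_mulVec_dotProduct]
      have h3 : Fᵀ *ᵥ A *ᵥ G *ᵥ t = 0 := (hG _).2 ⟨t, rfl⟩
      have h4 : Gᵀ *ᵥ A *ᵥ G *ᵥ t = 0 := by simpa [Matrix.mul_assoc] using ht0
      rw [h3, h4, zero_dotProduct, zero_dotProduct, add_zero]
    exact (smul_eq_zero.1 h2).resolve_left hF
  simpa using mulVec_eq_zero_of_det_ne_zero hAu.ne_zero h1

theorem orthogonal_orthogonal
    (hF : (Fᵀ * A * F).det ≠ 0)
    (hsat : ∀ (x : Fin n → ℤ) (c : ℤ), c ≠ 0 → (∃ y, F *ᵥ y = c • x) → ∃ y, F *ᵥ y = x)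
    (hM : (Gᵀ * A * G).det ≠ 0)
    (hG : ∀ x, Fᵀ *ᵥ A *ᵥ x = 0 ↔ ∃ y, G *ᵥ y = x) (hGF : Gᵀ * A * F = 0) (x : Fin n → ℤ) :
    Gᵀ *ᵥ A *ᵥ x = 0 ↔ ∃ y, F *ᵥ y = x := by
  have hGF' : ∀ s, Gᵀ *ᵥ A *ᵥ F *ᵥ s = 0 := fun s => by
    rw [mulVec_mulVec, mulVec_mulVec, hGF, zero_mulVec]
  constructor
  · intro hx
    obtain ⟨s, t, h⟩ := exists_smul_eq_add_of_orthogonal hG x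
    have ht : t = 0 := by
      refine mulVec_eq_zero_of_det_ne_zero hM ?_
      have h' := congrArg (fun y => Gᵀ *ᵥ A *ᵥ y) h
      simp only [mulVec_smul, hx, smul_zero, mulVec_add, hGF', zero_add] at h'
      rw [h', mulVec_mulVec, mulVec_mulVec, Matrix.mul_assoc]
    exact hsat x _ hF ⟨s, by rw [h, ht, mulVec_zero, add_zero]⟩
  · rintro ⟨s, rfl⟩
    exact hGF' s

/-- The map sending a lattice vector to the class of the functional it induces on a sublattice. -/
def toDiscGroup (A : Matrix (Fin n) (Fin n) ℤ) (F : Matrix (Fin n) (Fin k) ℤ) :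
    (Fin n → ℤ) →ₗ[ℤ] DiscGroup (Fᵀ * A * F) :=
  (LinearMap.range (Matrix.toLin' (Fᵀ * A * F))).mkQ ∘ₗ Fᵀ.mulVecLin ∘ₗ A.mulVecLin

theorem toDiscGroup_apply (x : Fin n → ℤ) :
    toDiscGroup A F x = discMk (Fᵀ * A * F) (Fᵀ *ᵥ A *ᵥ x) := rfl

theorem discMk_eq_discMk {B : Matrix (Fin n) (Fin n) ℤ} {v w : Fin n → ℤ} :
    discMk B v = discMk B w ↔ ∃ x, B *ᵥ x = v - w := by
  rw [discMk, discMk, Submodule.Quotient.eq]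
  rfl

theorem discMk_surjective {B : Matrix (Fin n) (Fin n) ℤ} :
    Function.Surjective (discMk B) :=
  Submodule.mkQ_surjective _

theorem transpose_mulVec_mulVec_surjective (hA : IsUnit A.det) (hF : ∀ z, ∃ x, Fᵀ *ᵥ x = z)
    (z : Fin k → ℤ) : ∃ x, Fᵀ *ᵥ A *ᵥ x = z := by
  obtain ⟨x, rfl⟩ := hF z
  exact ⟨A⁻¹ *ᵥ x, by rw [mulVec_mulVec x A, mul_nonsing_inv _ hA, one_mulVec]⟩

theorem toDiscGroup_surjective (hA : IsUnit A.det) (hF : ∀ z, ∃ x, Fᵀ *ᵥ x = z) :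
    Function.Surjective (toDiscGroup A F) := by
  intro y
  obtain ⟨z, rfl⟩ := discMk_surjective y
  obtain ⟨x, rfl⟩ := transpose_mulVec_mulVec_surjective hA hF z
  exact ⟨x, rfl⟩

theorem ker_toDiscGroup (hG : ∀ x, Fᵀ *ᵥ A *ᵥ x = 0 ↔ ∃ y, G *ᵥ y = x) :
    LinearMap.ker (toDiscGroup A F) = LinearMap.range F.mulVecLin ⊔ LinearMap.range G.mulVecLin := by
  ext x
  have h0 : (0 : DiscGroup (Fᵀ * A * F)) = discMk _ 0 := rfl
  rw [LinearMap.mem_ker, toDiscGroup_apply, h0, discMk_eq_discMk, sub_zero, Submodule.mem_sup]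
  constructor
  · rintro ⟨s, hs⟩
    obtain ⟨t, ht⟩ := (hG (x - F *ᵥ s)).1 (by
      rw [mulVec_sub, mulVec_sub, ← hs, ← mulVec_mulVec, ← mulVec_mulVec, sub_self])
    exact ⟨_, ⟨s, rfl⟩, _, ⟨t, rfl⟩, by rw [mulVecLin_apply, mulVecLin_apply, ht]; abel⟩
  · rintro ⟨_, ⟨s, rfl⟩, _, ⟨t, rfl⟩, rfl⟩
    refine ⟨s, ?_⟩
    rw [mulVec_add, mulVec_add, mulVecLin_apply, mulVecLin_apply, (hG (G *ᵥ t)).2 ⟨t, rfl⟩,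
      add_zero, mulVec_mulVec, mulVec_mulVec, Matrix.mul_assoc]

theorem exists_discGroup_equiv (hA : IsUnit A.det) (hFs : ∀ z, ∃ x, Fᵀ *ᵥ x = z)
    (hGs : ∀ z, ∃ x, Gᵀ *ᵥ x = z) (hG : ∀ x, Fᵀ *ᵥ A *ᵥ x = 0 ↔ ∃ y, G *ᵥ y = x)
    (hF : ∀ x, Gᵀ *ᵥ A *ᵥ x = 0 ↔ ∃ y, F *ᵥ y = x) :
    ∃ e : DiscGroup (Gᵀ * A * G) ≃+ DiscGroup (Fᵀ * A * F), ∀ x,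
      e (discMk _ (Gᵀ *ᵥ A *ᵥ x)) = discMk _ (Fᵀ *ᵥ A *ᵥ x) := by
  have hker : LinearMap.ker (toDiscGroup A G) = LinearMap.ker (toDiscGroup A F) := by
    rw [ker_toDiscGroup hG, ker_toDiscGroup hF, sup_comm]
  let eG := (toDiscGroup A G).quotKerEquivOfSurjective (toDiscGroup_surjective hA hGs)
  let eF := (toDiscGroup A F).quotKerEquivOfSurjective (toDiscGroup_surjective hA hFs)
  refine ⟨(eG.symm.trans ((Submodule.quotEquivOfEq _ _ hker).trans eF)).toAddEquiv, fun x => ?_⟩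
  have h : eG.symm (toDiscGroup A G x) = Submodule.Quotient.mk x :=
    eG.symm_apply_eq.2 rfl
  rw [← toDiscGroup_apply, ← toDiscGroup_apply]
  change eF (Submodule.quotEquivOfEq _ _ hker (eG.symm (toDiscGroup A G x))) = _
  rw [h]
  rfl

theorem transpose_fromCols_mul_mul (hFG : Fᵀ * A * G = 0) (hGF : Gᵀ * A * F = 0) :
    (fromCols F G)ᵀ * A * fromCols F G =
      Matrix.fromBlocks (Fᵀ * A * F) 0 0 (Gᵀ * A * G) := by
  rw [transpose_fromCols, fromRows_mul, fromRows_mul_fromCols, hFG, hGF]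

theorem qVal_add_qVal_orthogonal (hkm : k + m = n)
    (hF : (Fᵀ * A * F).det ≠ 0) (hG : (Gᵀ * A * G).det ≠ 0)
    (hFG : Fᵀ * A * G = 0) (hGF : Gᵀ * A * F = 0) (x : Fin n → ℤ) :
    qVal (Gᵀ * A * G) (Gᵀ *ᵥ A *ᵥ x) + qVal (Fᵀ * A * F) (Fᵀ *ᵥ A *ᵥ x) =
      ((x ⬝ᵥ A *ᵥ x : ℤ) : ℚ) := by
  have hH := transpose_fromCols_mul_mul hFG hGF
  set H := fromCols F G with hHdef
  have h1 : Sum.elim (Fᵀ *ᵥ A *ᵥ x) (Gᵀ *ᵥ A *ᵥ x) = Hᵀ *ᵥ A *ᵥ x := by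
    rw [hHdef, transpose_fromCols, fromRows_mulVec]
  rw [qVal_add_qVal hF hG, h1, ← hH]
  have hdet : IsUnit (ratMat (Hᵀ * A * H)).det := by
    rw [hH]
    exact isUnit_det_ratMat (fromBlocks_det_ne_zero hF hG)
  set E := (ratMat (Hᵀ * A * H))⁻¹
  have h2 : ratMat H * (E * (ratMat Hᵀ * ratMat A)) = 1 := by
    have hcard : Fintype.card (Fin n) = Fintype.card (Fin k ⊕ Fin m) := by simp [hkm]
    rw [mul_eq_one_comm_of_card_eq _ _ _ hcard]
    rw [Matrix.mul_assoc, ← ratMat_mul, ← ratMat_mul]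
    exact nonsing_inv_mul _ hdet
  rw [ratVec_dotProduct, ratVec_mulVec, ratVec_mulVec, ratMat_transpose,
    transpose_mulVec_dotProduct]
  have h3 : ratMat H *ᵥ E *ᵥ (ratMat H)ᵀ *ᵥ ratMat A *ᵥ ratVec x = ratVec x := by
    rw [← ratMat_transpose, mulVec_mulVec, mulVec_mulVec, mulVec_mulVec,
      Matrix.mul_assoc, Matrix.mul_assoc, h2, one_mulVec]
  rw [h3, dotProduct_comm]

end OrthogonalComplement

theorem latForm_mulVec {k n : ℕ} (A : Matrix (Fin n) (Fin n) ℤ) (F : Matrix (Fin n) (Fin k) ℤ)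
    (x y : Fin k → ℤ) : latForm A (F *ᵥ x) (F *ᵥ y) = latForm (Fᵀ * A * F) x y := by
  rw [latForm, latForm, dotProduct_comm, ← transpose_mulVec_dotProduct, dotProduct_comm,
    mulVec_mulVec, mulVec_mulVec, Matrix.mul_assoc]

theorem latForm_single {n : ℕ} (A : Matrix (Fin n) (Fin n) ℤ) (i j : Fin n) :
    latForm A (Pi.single i 1) (Pi.single j 1) = A i j := by
  simp [latForm]

theorem HasRealSignature.of_congr_int {ι κ : Type*} [Fintype ι] [DecidableEq ι] [Fintype κ]
    [DecidableEq κ] {A : Matrix ι ι ℤ} {D : Matrix κ κ ℤ} {H : Matrix ι κ ℤ}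
    (hcard : Fintype.card ι = Fintype.card κ) (hH : Hᵀ * A * H = D) {p q : ℕ}
    (h : HasRealSignature (D.map (Int.cast : ℤ → ℝ)) p q) :
    HasRealSignature (A.map (Int.cast : ℤ → ℝ)) p q := by
  refine of_congr (H := H.map (Int.cast : ℤ → ℝ)) hcard ?_ h
  rw [← hH]
  have h1 := Matrix.map_mul (L := Hᵀ * A) (M := H) (f := Int.castRingHom ℝ)
  have h2 := Matrix.map_mul (L := Hᵀ) (M := A) (f := Int.castRingHom ℝ)
  rw [h2] at h1
  exact h1.symm

theorem exists_complement_of_primitive {k n lp ln sp sn : ℕ} {BS : Matrix (Fin k) (Fin k) ℤ}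
    (hBS : IsEvenLattice BS) (hsigS : HasSignature BS sp sn) {BL : Matrix (Fin n) (Fin n) ℤ}
    (hBL : IsEvenLattice BL) (hdet : IsUnit BL.det) (hsigL : HasSignature BL lp ln)
    {f : (Fin k → ℤ) →ₗ[ℤ] (Fin n → ℤ)} (hf : IsPrimitiveEmbedding BS BL f) :
    ∃ mp mn : ℕ, mp + sp = lp ∧ mn + sn = ln ∧
      ∃ BM : Matrix (Fin (mp + mn)) (Fin (mp + mn)) ℤ,
        IsEvenLattice BM ∧ HasSignature BM mp mn ∧
        ∃ e : DiscGroup BM ≃+ DiscGroup BS,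
          ∀ (v : Fin (mp + mn) → ℤ) (w : Fin k → ℤ),
            e (discMk BM v) = discMk BS w →
            ∃ j : ℤ, qVal BM v + qVal BS w = 2 * j := by
  obtain ⟨hinj, hiso, hsat⟩ := hf
  obtain ⟨F, rfl⟩ : ∃ F : Matrix (Fin n) (Fin k) ℤ, f = F.mulVecLin :=
    ⟨LinearMap.toMatrix' f, (Matrix.toLin'_toMatrix' f).symm⟩
  obtain rfl : Fᵀ * BL * F = BS := by
    ext i j
    rw [← latForm_single (Fᵀ * BL * F), ← latForm_mulVec, ← latForm_single BS]
    exact hiso _ _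
  have hFs := transpose_mulVec_surjective_of_saturated hinj hsat
  obtain ⟨m, G, hkm, hGinj, hG⟩ := exists_basis_orthogonal hdet hFs
  have hFG := transpose_mul_mul_eq_zero_of_orthogonal hG
  have hGF := transpose_mul_mul_eq_zero_symm hBL.1 hFG
  have hM := det_orthogonal_ne_zero hdet hBS.2.1 hGinj hG
  have hF := orthogonal_orthogonal hBS.2.1 hsat hM hG hGF
  have hGs := transpose_mulVec_surjective_of_saturated hGinj fun x c hc h => by
    rw [← hG] at h ⊢
    rw [mulVec_smul, mulVec_smul] at h
    exact (smul_eq_zero.1 h).resolve_left hc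
  have hMsymm : (Gᵀ * BL * G).IsSymm := by
    rw [IsSymm, transpose_mul, transpose_mul, transpose_transpose, hBL.1.eq, Matrix.mul_assoc]
  have hMsymm' : ((Gᵀ * BL * G).map (Int.cast : ℤ → ℝ)).IsSymm := hMsymm.map _
  have hMR : ((Gᵀ * BL * G).map (Int.cast : ℤ → ℝ)).det ≠ 0 := by
    have h := (Int.castRingHom ℝ).map_det (Gᵀ * BL * G)
    rw [RingHom.mapMatrix_apply] at h
    exact h ▸ Int.cast_ne_zero.2 hM
  obtain ⟨mp, mn, hsigM⟩ := HasRealSignature.exists_of_det_ne_zero hMsymm' hMR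
  have hsum := hsigS.hasRealSignature.fromBlocks hsigM
  have hmap : fromBlocks ((Fᵀ * BL * F).map (Int.cast : ℤ → ℝ)) 0 0
      ((Gᵀ * BL * G).map (Int.cast : ℤ → ℝ)) =
      (fromBlocks (Fᵀ * BL * F) 0 0 (Gᵀ * BL * G)).map (Int.cast : ℤ → ℝ) := by
    simp [fromBlocks_map]
  rw [hmap] at hsum
  obtain ⟨hp, hn⟩ := hsigL.hasRealSignature.unique
    (HasRealSignature.of_congr_int (by simp [hkm]) (transpose_fromCols_mul_mul hFG hGF) hsum)
  obtain rfl : mp + mn = m := by simpa using hsigM.add_eq_card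
  obtain ⟨e, he⟩ := exists_discGroup_equiv hdet hFs hGs hG hF
  refine ⟨mp, mn, by lia, by lia, Gᵀ * BL * G, ⟨hMsymm, hM, fun i => ?_⟩, hsigM.hasSignature,
    e, fun v w hvw => ?_⟩
  · rw [← latForm_single (Gᵀ * BL * G), ← latForm_mulVec]
    exact even_dotProduct_mulVec hBL.1 hBL.2.2 _
  · obtain ⟨x, rfl⟩ := transpose_mulVec_mulVec_surjective hdet hGs v
    rw [he, eq_comm, discMk_eq_discMk] at hvw
    obtain ⟨s, hs⟩ := hvw
    obtain ⟨j, hj⟩ := even_dotProduct_mulVec hBL.1 hBL.2.2 (x + F *ᵥ s)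
    have h1 : Gᵀ *ᵥ BL *ᵥ (x + F *ᵥ s) = Gᵀ *ᵥ BL *ᵥ x := by
      rw [mulVec_add, mulVec_add, (hF _).2 ⟨s, rfl⟩, add_zero]
    have h2 : Fᵀ *ᵥ BL *ᵥ (x + F *ᵥ s) = w := by
      have h3 : Fᵀ *ᵥ BL *ᵥ F *ᵥ s = (Fᵀ * BL * F) *ᵥ s := by
        rw [mulVec_mulVec, mulVec_mulVec, Matrix.mul_assoc]
      rw [mulVec_add, mulVec_add, h3, hs]
      abel
    have h3 := qVal_add_qVal_orthogonal hkm hBS.2.1 hM hFG hGF (x + F *ᵥ s)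
    rw [h1, h2, hj] at h3
    exact ⟨j, by rw [h3]; push_cast; rfl⟩

/-- The lattice `S^∨ ⊕ M^∨` contains the overlattice of `S ⊕ M` glued along the graph of `e`; in the
dual coordinates it consists of the integer vectors `(w, v)` with `e [v] = [w]`. -/
def glueLattice {k m : ℕ} {BS : Matrix (Fin k) (Fin k) ℤ} {BM : Matrix (Fin m) (Fin m) ℤ}
    (e : DiscGroup BM ≃+ DiscGroup BS) : Submodule ℤ (Fin k ⊕ Fin m → ℤ) :=
  LinearMap.eqLocus
    (e.toAddMonoidHom.toIntLinearMap ∘ₗ (LinearMap.range (Matrix.toLin' BM)).mkQ ∘ₗ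
      LinearMap.funLeft ℤ ℤ Sum.inr)
    ((LinearMap.range (Matrix.toLin' BS)).mkQ ∘ₗ LinearMap.funLeft ℤ ℤ Sum.inl)

theorem discMk_mulVec {n : ℕ} {B : Matrix (Fin n) (Fin n) ℤ} (x : Fin n → ℤ) :
    discMk B (B *ᵥ x) = 0 :=
  discMk_eq_discMk.2 ⟨x, (sub_zero _).symm⟩

section Glue

variable {k m : ℕ} {BS : Matrix (Fin k) (Fin k) ℤ} {BM : Matrix (Fin m) (Fin m) ℤ}
  {e : DiscGroup BM ≃+ DiscGroup BS}

theorem elim_mem_glueLattice {w : Fin k → ℤ} {v : Fin m → ℤ} :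
    Sum.elim w v ∈ glueLattice e ↔ e (discMk BM v) = discMk BS w := Iff.rfl

theorem fromBlocks_mulVec_elim (s : Fin k → ℤ) (t : Fin m → ℤ) :
    fromBlocks BS 0 0 BM *ᵥ Sum.elim s t = Sum.elim (BS *ᵥ s) (BM *ᵥ t) := by
  simp [fromBlocks_mulVec]

theorem fromBlocks_mulVec_mem_glueLattice (y : Fin k ⊕ Fin m → ℤ) :
    fromBlocks BS 0 0 BM *ᵥ y ∈ glueLattice e := by
  rw [← Sum.elim_comp_inl_inr y, fromBlocks_mulVec_elim, elim_mem_glueLattice, discMk_mulVec,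
    discMk_mulVec, map_zero]

theorem exists_matrix_range_eq_glueLattice {n : ℕ} (hkm : k + m = n) (hS : BS.det ≠ 0)
    (hM : BM.det ≠ 0) (e : DiscGroup BM ≃+ DiscGroup BS) :
    ∃ N : Matrix (Fin k ⊕ Fin m) (Fin n) ℤ, ∀ u, u ∈ glueLattice e ↔ ∃ c, N *ᵥ c = u := by
  let D := fromBlocks BS 0 0 BM
  have hrank : Module.finrank ℤ (glueLattice e) = n := by
    refine le_antisymm ?_ ?_
    · simpa [hkm] using (glueLattice e).finrank_le
    · have h := LinearMap.finrank_le_finrank_of_injective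
        (f := D.mulVecLin.codRestrict (glueLattice e) fromBlocks_mulVec_mem_glueLattice) (by
          refine (injective_iff_map_eq_zero _).2 fun x hx => ?_
          exact mulVec_eq_zero_of_det_ne_zero (fromBlocks_det_ne_zero hS hM)
            (congrArg Subtype.val hx))
      simpa [hkm] using h
  let b := (Module.finBasis ℤ (glueLattice e)).reindex (finCongr hrank)
  let g : (Fin n → ℤ) →ₗ[ℤ] (Fin k ⊕ Fin m → ℤ) :=
    (glueLattice e).subtype ∘ₗ b.equivFun.symm.toLinearMap
  refine ⟨LinearMap.toMatrix' g, fun u => ?_⟩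
  have hg : ∀ y, LinearMap.toMatrix' g *ᵥ y = g y := fun y => LinearMap.toMatrix'_mulVec g y
  simp only [hg]
  refine ⟨fun h => ⟨b.equivFun ⟨u, h⟩, by simp [g]⟩, ?_⟩
  rintro ⟨y, rfl⟩
  exact (b.equivFun.symm y).2

end Glue

theorem exists_even_gram {ι κ : Type*} [Fintype ι] [DecidableEq ι] [Fintype κ] [DecidableEq κ]
    {D : Matrix κ κ ℤ} (hD : D.IsSymm) (hDdet : D.det ≠ 0) {N : Matrix κ ι ℤ}
    (hN : ∀ y, ∃ c, N *ᵥ c = D *ᵥ y)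
    (heven : ∀ c, ∃ j : ℤ, ratVec (N *ᵥ c) ⬝ᵥ (ratMat D)⁻¹ *ᵥ ratVec (N *ᵥ c) = 2 * j) :
    ∃ (B : Matrix ι ι ℤ) (H : Matrix ι κ ℤ), B.IsSymm ∧ (∀ i, 2 ∣ B i i) ∧
      N * H = D ∧ B * H = Nᵀ := by
  set E := (ratMat D)⁻¹ with hE
  have hEsymm : E.IsSymm := IsSymm.inv (hD.map _)
  set M := (ratMat N)ᵀ * E * ratMat N with hM
  have hMsymm : M.IsSymm := by
    rw [IsSymm, hM, transpose_mul, transpose_mul, transpose_transpose, hEsymm.eq, Matrix.mul_assoc]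
  have hQ : ∀ c, ∃ j : ℤ, ratVec c ⬝ᵥ M *ᵥ ratVec c = 2 * j := by
    intro c
    obtain ⟨j, hj⟩ := heven c
    refine ⟨j, ?_⟩
    rw [← hj, ratVec_mulVec, hM, ← mulVec_mulVec, ← mulVec_mulVec, dotProduct_comm,
      transpose_mulVec_dotProduct, dotProduct_comm]
  have hsingle : ∀ i, ratVec (Pi.single i 1 : ι → ℤ) = Pi.single i 1 := fun i => by
    ext j
    by_cases h : j = i
    · subst h; simp [ratVec]
    · simp [ratVec, h]
  have hdiag : ∀ i, ∃ j : ℤ, M i i = 2 * j := fun i => by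
    obtain ⟨j, hj⟩ := hQ (Pi.single i 1)
    rw [hsingle] at hj
    exact ⟨j, by simpa using hj⟩
  have hint : ∀ i j, ∃ b : ℤ, M i j = b := fun i j => by
    obtain ⟨a, ha⟩ := hdiag i
    obtain ⟨b, hb⟩ := hdiag j
    obtain ⟨c, hc⟩ := hQ (Pi.single i 1 + Pi.single j 1)
    have h1 : ratVec (Pi.single i 1 + Pi.single j 1 : ι → ℤ) = Pi.single i 1 + Pi.single j 1 := by
      rw [← hsingle, ← hsingle]
      ext l
      simp [ratVec]
    have h2 := hMsymm.apply i j
    rw [h1] at hc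
    simp [mulVec_add] at hc
    refine ⟨c - a - b, ?_⟩
    push_cast
    linarith
  choose B hB using hint
  have hBM : ratMat (Matrix.of B) = M := by
    ext i j
    exact (hB i j).symm
  choose H hH using fun j => hN (Pi.single j 1)
  have hNH : N * (Matrix.of H)ᵀ = D := by
    ext i j
    have h := congrFun (hH j) i
    rw [mulVec_single_one] at h
    exact h
  refine ⟨Matrix.of B, (Matrix.of H)ᵀ, ?_, fun i => ?_, hNH, ratMat_injective ?_⟩
  · refine ratMat_injective ?_
    rw [ratMat_transpose, hBM, hMsymm.eq]
  · obtain ⟨j, hj⟩ := hdiag i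
    exact ⟨j, by exact_mod_cast (hB i i).symm.trans hj⟩
  · rw [ratMat_mul, hBM, hM, Matrix.mul_assoc, ← ratMat_mul, hNH, Matrix.mul_assoc, hE,
      nonsing_inv_mul _ (isUnit_det_ratMat hDdet), Matrix.mul_one, ratMat_transpose]

theorem transpose_mulVec_injective_of_mul_eq {ι κ : Type*} [Fintype ι] [DecidableEq ι] [Fintype κ]
    [DecidableEq κ] (hcard : Fintype.card ι = Fintype.card κ) {D : Matrix κ κ ℤ}
    (hD : D.det ≠ 0) {N : Matrix κ ι ℤ} {H : Matrix ι κ ℤ} (h : N * H = D) :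
    Function.Injective Hᵀ.mulVec := by
  have h1 : (ratMat D)⁻¹ * ratMat N * ratMat H = 1 := by
    rw [Matrix.mul_assoc, ← ratMat_mul, h, nonsing_inv_mul _ (isUnit_det_ratMat hD)]
  rw [mul_eq_one_comm_of_card_eq _ _ _ hcard.symm] at h1
  have h2 := congrArg transpose h1
  rw [transpose_mul, transpose_one] at h2
  intro x y hxy
  refine ratVec_injective ?_
  have h3 := congrArg ratVec hxy
  simp only [ratVec_mulVec, ratMat_transpose] at h3
  rw [← one_mulVec (ratVec x), ← one_mulVec (ratVec y), ← h2, ← mulVec_mulVec, ← mulVec_mulVec, h3]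

theorem isUnit_det_of_mulVec_surjective {ι : Type*} [Fintype ι] [DecidableEq ι]
    {B : Matrix ι ι ℤ} (h : ∀ z, ∃ c, B *ᵥ c = z) : IsUnit B.det := by
  choose C hC using fun j => h (Pi.single j 1)
  refine isUnit_det_of_right_inverse (B := (Matrix.of C)ᵀ) ?_
  ext i j
  have h := congrFun (hC j) i
  rw [Pi.single_apply, eq_comm] at h
  rw [one_apply, h]
  rfl

section Glue

variable {k m n : ℕ} {BS : Matrix (Fin k) (Fin k) ℤ} {BM : Matrix (Fin m) (Fin m) ℤ}
  {e : DiscGroup BM ≃+ DiscGroup BS} {N : Matrix (Fin k ⊕ Fin m) (Fin n) ℤ}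
  {B : Matrix (Fin n) (Fin n) ℤ} {H : Matrix (Fin n) (Fin k ⊕ Fin m) ℤ}

theorem isUnit_det_of_glue (hkm : k + m = n) (hS : BS.det ≠ 0) (hM : BM.det ≠ 0)
    (hN : ∀ u, u ∈ glueLattice e ↔ ∃ c, N *ᵥ c = u) (hB : B.IsSymm)
    (hNH : N * H = fromBlocks BS 0 0 BM) (hBH : B * H = Nᵀ) : IsUnit B.det := by
  have hinj := transpose_mulVec_injective_of_mul_eq (by simp [hkm])
    (fromBlocks_det_ne_zero hS hM) hNH
  have hHB : Hᵀ * B = N := by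
    have h := congrArg transpose hBH
    rwa [transpose_mul, hB.eq, transpose_transpose] at h
  refine isUnit_det_of_mulVec_surjective fun z => ?_
  suffices h : ∃ c, N *ᵥ c = Hᵀ *ᵥ z by
    obtain ⟨c, hc⟩ := h
    refine ⟨c, hinj ?_⟩
    simp only [mulVec_mulVec, hHB, hc]
  rw [← hN]
  obtain ⟨w, v, hwv⟩ : ∃ w v, Hᵀ *ᵥ z = Sum.elim w v := ⟨_, _, (Sum.elim_comp_inl_inr _).symm⟩
  obtain ⟨w', hw'⟩ := discMk_surjective (e (discMk BM v))
  obtain ⟨c, hc⟩ := (hN (Sum.elim w' v)).1 (elim_mem_glueLattice.2 hw'.symm)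
  have ht : Hᵀ *ᵥ (z - B *ᵥ c) = Sum.elim (w - w') 0 := by
    rw [mulVec_sub, mulVec_mulVec, hHB, hc, hwv]
    ext (i | i) <;> simp
  set t := z - B *ᵥ c
  have hs0 : BS *ᵥ (BS.adjugate *ᵥ (w - w')) = BS.det • (w - w') := by
    rw [mulVec_mulVec, mul_adjugate, smul_mulVec, one_mulVec]
  set s := BS.adjugate *ᵥ (w - w')
  have hs : Nᵀ *ᵥ Sum.elim s 0 = BS.det • t := by
    refine hinj ?_
    rw [mulVec_smul, ht, ← hBH, mulVec_mulVec, ← Matrix.mul_assoc, hHB, hNH,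
      fromBlocks_mulVec_elim, hs0]
    ext (i | i) <;> simp
  have hdvd : ∀ i, BS.det ∣ s i := fun i => by
    obtain ⟨v', hv'⟩ := discMk_surjective (e.symm (discMk BS (Pi.single i 1)))
    obtain ⟨a, ha⟩ := (hN (Sum.elim (Pi.single i 1) v')).1
      (elim_mem_glueLattice.2 (by rw [hv', e.apply_symm_apply]))
    refine ⟨t ⬝ᵥ a, ?_⟩
    rw [← smul_eq_mul, ← smul_dotProduct, ← hs, transpose_mulVec_dotProduct, ha]
    simp [sumElim_dotProduct_sumElim]
  choose s' hs' using hdvd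
  have hss' : BS *ᵥ s' = w - w' := by
    refine smul_right_injective _ hS ?_
    change BS.det • BS *ᵥ s' = BS.det • (w - w')
    rw [← hs0, ← mulVec_smul]
    congr 1
    ext i
    simp [hs']
  rw [hwv, elim_mem_glueLattice, ← hw']
  exact discMk_eq_discMk.2 ⟨-s', by rw [mulVec_neg, hss', neg_sub]⟩

theorem isPrimitiveEmbedding_of_glue (hS : BS.det ≠ 0)
    (hkm : k + m = n) (hM : BM.det ≠ 0)
    (hN : ∀ u, u ∈ glueLattice e ↔ ∃ c, N *ᵥ c = u) (hB : B.IsSymm)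
    (hNH : N * H = fromBlocks BS 0 0 BM) (hBH : B * H = Nᵀ) :
    IsPrimitiveEmbedding BS B H.toCols₁.mulVecLin := by
  have hHB : Hᵀ * B = N := by
    have h := congrArg transpose hBH
    rwa [transpose_mul, hB.eq, transpose_transpose] at h
  have happ : ∀ s, H.toCols₁ *ᵥ s = H *ᵥ Sum.elim s 0 := fun s => by
    conv_rhs => rw [← fromCols_toCols H, fromCols_mulVec_sumElim]
    simp
  have hgram : (H.toCols₁)ᵀ * B * H.toCols₁ = BS := by
    have h : Hᵀ * B * H = fromBlocks BS 0 0 BM := by rw [hHB, hNH]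
    rw [← fromCols_toCols H, transpose_fromCols, fromRows_mul, fromRows_mul_fromCols,
      fromBlocks_inj] at h
    simpa using h.1
  have hNinj : Function.Injective N.mulVec := by
    have hDs : (fromBlocks BS 0 0 BM)ᵀ.det ≠ 0 := by
      rw [det_transpose]; exact fromBlocks_det_ne_zero hS hM
    have h := transpose_mulVec_injective_of_mul_eq (N := Hᵀ) (H := Nᵀ) (by simp [hkm]) hDs
      (by rw [← transpose_mul, hNH])
    rwa [transpose_transpose] at h
  refine ⟨?_, fun x y => ?_, fun x c hc hx => ?_⟩
  · rw [injective_iff_map_eq_zero]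
    intro s hs
    refine mulVec_eq_zero_of_det_ne_zero hS ?_
    rw [mulVecLin_apply] at hs
    rw [← hgram, ← mulVec_mulVec, hs, mulVec_zero]
  · rw [mulVecLin_apply, mulVecLin_apply, latForm_mulVec, hgram]
  · obtain ⟨s, hs⟩ := hx
    rw [mulVecLin_apply, happ] at hs
    obtain ⟨w, v, hwv⟩ : ∃ w v, N *ᵥ x = Sum.elim w v :=
      ⟨_, _, (Sum.elim_comp_inl_inr _).symm⟩
    have h1 := congrArg N.mulVec hs
    rw [mulVec_mulVec, hNH, fromBlocks_mulVec_elim, mulVec_zero, mulVec_smul, hwv] at h1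
    have hv : v = 0 := by
      ext i
      have h2 := congrFun h1 (Sum.inr i)
      simpa [hc] using h2.symm
    have h3 := (hN _).2 ⟨x, hwv⟩
    rw [elim_mem_glueLattice, hv, show discMk BM 0 = 0 from rfl, map_zero,
      show (0 : DiscGroup BS) = discMk BS 0 from rfl, eq_comm, discMk_eq_discMk, sub_zero] at h3
    obtain ⟨s', hs'⟩ := h3
    refine ⟨s', hNinj ?_⟩
    rw [mulVecLin_apply, happ, mulVec_mulVec, hNH, fromBlocks_mulVec_elim, hs', mulVec_zero, hwv,
      hv]

end Glue

theorem exists_unimodular_of_complement {k m n lp ln : ℕ} {BS : Matrix (Fin k) (Fin k) ℤ}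
    {BM : Matrix (Fin m) (Fin m) ℤ} {sp sn mp mn : ℕ} (hkm : k + m = n) (hp : mp + sp = lp)
    (hn : mn + sn = ln)
    (hBS : IsEvenLattice BS) (hsigS : HasSignature BS sp sn)
    (hBM : IsEvenLattice BM) (hsigM : HasSignature BM mp mn) (e : DiscGroup BM ≃+ DiscGroup BS)
    (he : ∀ (v : Fin m → ℤ) (w : Fin k → ℤ), e (discMk BM v) = discMk BS w →
      ∃ j : ℤ, qVal BM v + qVal BS w = 2 * j) :
    ∃ BL : Matrix (Fin n) (Fin n) ℤ,
      IsEvenLattice BL ∧ IsUnit BL.det ∧ HasSignature BL lp ln ∧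
      ∃ f : (Fin k → ℤ) →ₗ[ℤ] (Fin n → ℤ), IsPrimitiveEmbedding BS BL f := by
  obtain ⟨N, hN⟩ := exists_matrix_range_eq_glueLattice hkm hBS.2.1 hBM.2.1 e
  obtain ⟨B, H, hB, hdiag, hNH, hBH⟩ := exists_even_gram (N := N)
    (hBS.1.fromBlocks (by simp) hBM.1) (fromBlocks_det_ne_zero hBS.2.1 hBM.2.1)
    (fun y => (hN _).1 (fromBlocks_mulVec_mem_glueLattice y)) fun c => by
      obtain ⟨w, v, hwv⟩ : ∃ w v, N *ᵥ c = Sum.elim w v :=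
        ⟨_, _, (Sum.elim_comp_inl_inr _).symm⟩
      rw [hwv, ← qVal_add_qVal hBS.2.1 hBM.2.1]
      exact he v w (elim_mem_glueLattice.1 ((hN _).2 ⟨c, hwv⟩))
  have hunit := isUnit_det_of_glue hkm hBS.2.1 hBM.2.1 hN hB hNH hBH
  refine ⟨B, ⟨hB, hunit.ne_zero, hdiag⟩, hunit, ?_, _,
    isPrimitiveEmbedding_of_glue hBS.2.1 hkm hBM.2.1 hN hB hNH hBH⟩
  have hH : Hᵀ * B * H = fromBlocks BS 0 0 BM := by
    have h := congrArg transpose hBH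
    rw [transpose_mul, hB.eq, transpose_transpose] at h
    rw [h, hNH]
  have hsum := hsigS.hasRealSignature.fromBlocks hsigM.hasRealSignature
  have hmap : fromBlocks (BS.map (Int.cast : ℤ → ℝ)) 0 0 (BM.map (Int.cast : ℤ → ℝ)) =
      (fromBlocks BS 0 0 BM).map (Int.cast : ℤ → ℝ) := by
    simp [fromBlocks_map]
  rw [hmap, add_comm sp, add_comm sn, hp, hn] at hsum
  exact (HasRealSignature.of_congr_int (by simp [hkm]) hH hsum).hasSignature

/-- **Nikulin's embedding criterion.**  An even lattice `S` of signature
`(s₊, s₋)` embeds primitively into some even unimodular lattice of signature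
`(l₊, l₋)` if and only if there exists an even lattice `M` of signature
`(l₊ - s₊, l₋ - s₋)` whose discriminant group is isomorphic to that of `S` by
an isomorphism carrying the discriminant form `q_M` to `-q_S`. -/
theorem nikulin_embedding {k : ℕ} (sp sn : ℕ) (BS : Matrix (Fin k) (Fin k) ℤ)
    (hBS : IsEvenLattice BS) (hsigS : HasSignature BS sp sn) (lp ln : ℕ) :
    (∃ BL : Matrix (Fin (lp + ln)) (Fin (lp + ln)) ℤ,
      IsEvenLattice BL ∧ IsUnit BL.det ∧ HasSignature BL lp ln ∧
      ∃ f : (Fin k → ℤ) →ₗ[ℤ] (Fin (lp + ln) → ℤ), IsPrimitiveEmbedding BS BL f) ↔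
    (∃ mp mn : ℕ, mp + sp = lp ∧ mn + sn = ln ∧
      ∃ BM : Matrix (Fin (mp + mn)) (Fin (mp + mn)) ℤ,
        IsEvenLattice BM ∧ HasSignature BM mp mn ∧
        ∃ e : DiscGroup BM ≃+ DiscGroup BS,
          ∀ (v : Fin (mp + mn) → ℤ) (w : Fin k → ℤ),
            e (discMk BM v) = discMk BS w →
            ∃ j : ℤ, qVal BM v + qVal BS w = 2 * j) := by
  constructor
  · rintro ⟨BL, hBL, hdet, hsigL, f, hf⟩
    exact exists_complement_of_primitive hBS hsigS hBL hdet hsigL hf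
  · rintro ⟨mp, mn, hp, hn, BM, hBM, hsigM, e, he⟩
    have hk := hsigS.1
    exact exists_unimodular_of_complement (by lia) hp hn hBS hsigS hBM hsigM e he
end

section
/- The lattice S₁₁ contains no vectors of square −2: there is no x ∈ ℤ²⁰ with xᵀMx = −2. -/
open Matrix

/-- The Gram matrix of the lattice `S₁₁`. -/
def S11 : Matrix (Fin 20) (Fin 20) ℤ :=
  !![-4, 1, -2, -2, -1, 1, -1, 1, -1, -1, 2, 1, -1, 2, -1, -2, -2, 2, 1, -1;
     1, -4, -1, -1, -1, -1, -1, 1, -1, 2, -1, -2, 2, 0, -1, 0, 0, -1, -2, 1;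
     -2, -1, -4, -2, -1, -1, 0, 1, 0, -1, 1, 0, -1, 2, -2, -1, -1, 0, 0, 1;
     -2, -1, -2, -4, 0, 0, -2, 0, -1, 0, 2, 1, 0, 1, 0, 0, -1, 1, 0, -1;
     -1, -1, -1, 0, -4, 1, -1, 2, -2, -1, 1, 0, -1, 0, -2, -2, 0, 1, 1, -1;
     1, -1, -1, 0, 1, -4, 0, -1, 0, 1, -2, -1, 0, -1, -1, 0, -1, 0, -1, 1;
     -1, -1, 0, -2, -1, 0, -4, 1, -2, 1, 1, 1, 0, -1, 0, -1, 0, 2, 0, -2;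
     1, 1, 1, 0, 2, -1, 1, -4, 0, 0, -1, 1, 1, 0, 2, 1, 0, -1, 1, 0;
     -1, -1, 0, -1, -2, 0, -2, 0, -4, 0, 0, 1, 1, 0, -1, -2, 0, 2, 0, -2;
     -1, 2, -1, 0, -1, 1, 1, 0, 0, -4, 1, 1, -2, 1, 0, 0, 1, 1, 1, 0;
     2, -1, 1, 2, 1, -2, 1, -1, 0, 1, -4, -2, 2, -1, 0, 0, 0, -1, -2, 1;
     1, -2, 0, 1, 0, -1, 1, 1, 1, 1, -2, -4, 1, 0, -1, 0, -1, -1, -2, 2;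
     -1, 2, -1, 0, -1, 0, 0, 1, 1, -2, 2, 1, -4, 0, -1, 0, 0, 1, 2, 0;
     2, 0, 2, 1, 0, -1, -1, 0, 0, 1, -1, 0, 0, -4, 1, 1, 1, 0, 0, -1;
     -1, -1, -2, 0, -2, -1, 0, 2, -1, 0, 0, -1, -1, 1, -4, -2, -1, 1, 0, 0;
     -2, 0, -1, 0, -2, 0, -1, 1, -2, 0, 0, 0, 0, 1, -2, -4, -2, 2, 0, -1;
     -2, 0, -1, -1, 0, -1, 0, 0, 0, 1, 0, -1, 0, 1, -1, -2, -4, 1, 0, 0;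
     2, -1, 0, 1, 1, 0, 2, -1, 2, 1, -1, -1, 1, 0, 1, 2, 1, -4, 0, 2;
     1, -2, 0, 0, 1, -1, 0, 1, 0, 1, -2, -2, 2, 0, 0, 0, 0, 0, -4, 1;
     -1, 1, 1, -1, -1, 1, -2, 0, -2, 0, 1, 2, 0, -1, 0, -1, 0, 2, 1, -4]

/-- The sum of the products of the corresponding entries of two integer lists. -/
def listDot : List ℤ → List ℤ → ℤ
  | a :: l, x :: xs => a * x + listDot l xs
  | _, _ => 0

/-- The quadratic form `∑ w (a y + r ⬝ xs)²` given by a list of triples `(w, a, r)`, in triangular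
shape: it is evaluated at the coordinates `ys`, each of which is moved to the front of the list
`xs` of known coordinates once its square has been added. -/
def triangularForm : List (ℤ × ℤ × List ℤ) → List ℤ → List ℤ → ℤ
  | (w, a, r) :: rows, xs, y :: ys =>
    w * (a * y + listDot r xs) ^ 2 + triangularForm rows (y :: xs) ys
  | _, _, _ => 0

/-- Fincke–Pohst search certifying that a triangular form does not take the value `T`
at any integer vector extending `xs`. -/
def omitsValue : List (ℤ × ℤ × List ℤ) → List ℤ → ℤ → Bool
  | [], _, T => !decide (T = 0)
  | (w, a, r) :: rows, xs, T =>
    decide (0 < a) && (decide (T < w * (3 * a) ^ 2) &&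
      [-3, -2, -1, 0, 1, 2].all fun k : ℤ ↦
        decide (T < w * (a * (k - listDot r xs / a) + listDot r xs) ^ 2) ||
          omitsValue rows ((k - listDot r xs / a) :: xs)
            (T - w * (a * (k - listDot r xs / a) + listDot r xs) ^ 2))

theorem triangularForm_nonneg (rows : List (ℤ × ℤ × List ℤ)) (xs ys : List ℤ)
    (hw : ∀ row ∈ rows, 0 < row.1) : 0 ≤ triangularForm rows xs ys := by
  induction rows generalizing xs ys with
  | nil => simp [triangularForm]
  | cons row rows ih =>
    obtain ⟨w, a, r⟩ := row
    cases ys with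
    | nil => simp [triangularForm]
    | cons y ys =>
      have hw₀ : 0 < w := hw (w, a, r) (by simp)
      have := ih (y :: xs) ys fun row h ↦ hw row (by simp [h])
      simp only [triangularForm]
      positivity

/-- If `a y + c` is less than `3 a` in absolute value, then `y` is within `3` of `-⌊c / a⌋`. -/
theorem add_ediv_mem_of_sq_lt {w a c y : ℤ} (hw : 0 < w) (ha : 0 < a)
    (h : w * (a * y + c) ^ 2 < w * (3 * a) ^ 2) :
    y + c / a ∈ [-3, -2, -1, 0, 1, 2] := by
  obtain ⟨hlo, hhi⟩ := abs_lt_of_sq_lt_sq' (lt_of_mul_lt_mul_left h hw.le) (by positivity)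
  have hdiv := Int.mul_ediv_add_emod c a
  have hmod := Int.emod_nonneg c ha.ne'
  have hmod' := Int.emod_lt_of_pos c ha
  have h₁ : -4 < y + c / a := by
    refine lt_of_mul_lt_mul_left (a := a) ?_ ha.le
    linarith [mul_add a y (c / a)]
  have h₂ : y + c / a < 3 := by
    refine lt_of_mul_lt_mul_left (a := a) ?_ ha.le
    linarith [mul_add a y (c / a)]
  simp only [List.mem_cons, List.not_mem_nil, or_false]
  lia

theorem triangularForm_ne_of_omitsValue (rows : List (ℤ × ℤ × List ℤ)) (xs ys : List ℤ) (T : ℤ)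
    (hw : ∀ row ∈ rows, 0 < row.1) (hlen : ys.length = rows.length)
    (h : omitsValue rows xs T = true) : triangularForm rows xs ys ≠ T := by
  induction rows generalizing xs ys T with
  | nil =>
    simp only [omitsValue, Bool.not_eq_true', decide_eq_false_iff_not] at h
    simpa [triangularForm] using Ne.symm h
  | cons row rows ih =>
    obtain ⟨w, a, r⟩ := row
    cases ys with
    | nil => simp at hlen
    | cons y ys =>
      intro hT
      have hw₀ : 0 < w := hw (w, a, r) (by simp)
      have hw' : ∀ row ∈ rows, 0 < row.1 := fun row h ↦ hw row (by simp [h])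
      have hrest := triangularForm_nonneg rows (y :: xs) ys hw'
      simp only [triangularForm] at hT
      simp only [omitsValue, Bool.and_eq_true, decide_eq_true_eq, List.all_eq_true,
        Bool.or_eq_true] at h
      obtain ⟨ha, hbound, hall⟩ := h
      have hy := hall _ (add_ediv_mem_of_sq_lt hw₀ ha (c := listDot r xs) (y := y) (by linarith))
      rw [add_sub_cancel_right] at hy
      rcases hy with hy | hy
      · linarith
      · exact ih _ ys _ hw' (by simpa using hlen) hy (by linarith)

/-- The triangular form obtained from `-S11` by completing squares and clearing denominators;
the last coordinate comes first. -/
def S11Rows : List (ℤ × ℤ × List ℤ) :=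
  [(479741919426691690909140, 1, []),
   (938829587919161821740, 20, [7]),
   (1641310468390143045, 511, [-109, -217]),
   (381058450407706995, 1040, [-267, -287, -371]),
   (138760780260509550, 2201, [832, -1094, 1091, -737]),
   (1207163942108227350, 714, [-149, -298, -190, -347, 167]),
   (907279004910815082, 1012, [-464, -485, -464, 346, -199, -139]),
   (41636420867483442, 3800, [-1524, 1078, -1455, -822, 658, -977, -1747]),
   (36136301073877604600, 149, [18, -32, 68, 68, 59, -3, -8, -14]),
   (944947149878512300, 999, [259, -450, 272, 70, 313, 295, 147, 419, 443]),
   (209778267273029730600, 77, [25, 35, 4, -12, -28, -24, -30, -28, 37, -32]),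
   (113753004084671051100, 108, [28, 23, -47, -46, -24, 34, 33, -51, -47, 47, 35]),
   (10186836186686959800, 426, [168, 12, 91, -152, -182, -132, -168, 75, -32, 132, -203, 15]),
   (40181409403043008100, 201, [-84, 15, -42, -17, -71, 34, 60, -15, 39, -89, -60, 7, 48]),
   (88267358360783001400, 162, [48, 42, 60, -33, 67, 13, 28, 78, 48, 48, 76, -78, 1, 30]),
   (170229905410081502700, 122, [-42, 35, -38, 59, 56, -49, -35, 56, 34, 35, 35, -31, -34, -59, 60]),
   (10384024230014971664700, 14, [-6, 0, 7, 6, 1, 0, -7, -7, 0, 2, -7, -7, -1, -2, -1, 6]),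
   (14537633922020960330580, 12, [2, 0, 6, -5, 0, -5, 6, -1, -1, 6, -4, 5, -1, -1, 4, -1, -6]),
   (14537633922020960330580, 15, [6, 6, 5, 3, 5, -5, 5, -7, 2, 7, -7, -2, 5, 2, 2, 2, 7, -3]),
   (218064508830314404958700, 4, [-1, 2, 2, 1, -1, 1, -1, 1, 1, -2, -1, 1, -2, 1, 2, 2, -2, -1, 1])]

theorem triangularForm_S11Rows (x : Fin 20 → ℤ) :
    triangularForm S11Rows [] (List.ofFn x).reverse =
      -872258035321257619834800 * (x ⬝ᵥ S11.mulVec x) := by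
  simp [S11Rows, triangularForm, listDot, S11, dotProduct, mulVec, Fin.sum_univ_succ,
    List.ofFn_succ]
  ring

theorem omitsValue_S11Rows : omitsValue S11Rows [] 1744516070642515239669600 = true := by
  decide +kernel

/-- The lattice `S₁₁` contains no vectors of square `-2`. -/
theorem S11_no_roots : ¬ ∃ x : Fin 20 → ℤ, x ⬝ᵥ S11.mulVec x = -2 := by
  rintro ⟨x, hx⟩
  refine triangularForm_ne_of_omitsValue S11Rows [] (List.ofFn x).reverse _ (by decide)
    (by simp [S11Rows]) omitsValue_S11Rows ?_
  rw [triangularForm_S11Rows, hx]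
  norm_num
end

section
/- In the symmetric group on the 24-element set {∞, 0, 1, 2, ..., 22}, let α = (15 7 14 5 10 20 17 11 22 21 19)(3 6 12 1 2 4 8 16 9 18 13), β = (14 17 11 19 22)(20 10 7 5 21)(18 4 2 6 1)(8 16 13 9 12), and γ = (2 4)(5 10)(6 18)(8 12)(9 16)(11 17)(14 19)(20 21). Then the subgroup generated by α, β and γ is isomorphic to PSL₂(𝔽₁₁), the projective special linear group of 2×2 matrices over the field with 11 elements (a simple group of order 660). -/
/-!
The subgroup of the symmetric group on the 24-element set
`{∞, 0, 1, …, 22}` generated by the three permutations `α`, `β`, `γ` below is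
isomorphic to `PSL₂(𝔽₁₁)`.

The 24-element set is modelled by `Fin 24`, with the point `k` (for
`0 ≤ k ≤ 22`) corresponding to `k : Fin 24` and `∞` corresponding to
`23 : Fin 24` (both `∞` and `0` are fixed by all three permutations).
-/

/-- `α = (15 7 14 5 10 20 17 11 22 21 19)(3 6 12 1 2 4 8 16 9 18 13)`. -/
def α : Equiv.Perm (Fin 24) :=
  ([15, 7, 14, 5, 10, 20, 17, 11, 22, 21, 19] : List (Fin 24)).formPerm *
  ([3, 6, 12, 1, 2, 4, 8, 16, 9, 18, 13] : List (Fin 24)).formPerm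

/-- `β = (14 17 11 19 22)(20 10 7 5 21)(18 4 2 6 1)(8 16 13 9 12)`. -/
def β : Equiv.Perm (Fin 24) :=
  ([14, 17, 11, 19, 22] : List (Fin 24)).formPerm *
  ([20, 10, 7, 5, 21] : List (Fin 24)).formPerm *
  ([18, 4, 2, 6, 1] : List (Fin 24)).formPerm *
  ([8, 16, 13, 9, 12] : List (Fin 24)).formPerm

/-- `γ = (2 4)(5 10)(6 18)(8 12)(9 16)(11 17)(14 19)(20 21)`. -/
def γ : Equiv.Perm (Fin 24) :=
  ([2, 4] : List (Fin 24)).formPerm * ([5, 10] : List (Fin 24)).formPerm *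
  ([6, 18] : List (Fin 24)).formPerm * ([8, 12] : List (Fin 24)).formPerm *
  ([9, 16] : List (Fin 24)).formPerm * ([11, 17] : List (Fin 24)).formPerm *
  ([14, 19] : List (Fin 24)).formPerm * ([20, 21] : List (Fin 24)).formPerm

/-- `SL₂(𝔽₁₁)`. -/
abbrev SL211 := Matrix.SpecialLinearGroup (Fin 2) (ZMod 11)

namespace PSL211

open OnePoint Matrix Matrix.SpecialLinearGroup

instance : Fact (Nat.Prime 11) := ⟨by norm_num⟩

instance : DecidableEq (OnePoint (ZMod 11)) := inferInstanceAs (DecidableEq (Option (ZMod 11)))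

section Generation

variable (R : Type*) [CommRing R]

/-- The matrix `[[0, -1], [1, 0]]` over an arbitrary commutative ring. -/
def matS : SpecialLinearGroup (Fin 2) R := ⟨!![0, -1; 1, 0], by simp [det_fin_two_of]⟩

/-- The matrix `[[1, 1], [0, 1]]` over an arbitrary commutative ring. -/
def matT : SpecialLinearGroup (Fin 2) R := ⟨!![1, 1; 0, 1], by simp [det_fin_two_of]⟩

@[simp]
theorem coe_matS : (matS R : Matrix (Fin 2) (Fin 2) R) = !![0, -1; 1, 0] := rfl

@[simp]
theorem coe_matT : (matT R : Matrix (Fin 2) (Fin 2) R) = !![1, 1; 0, 1] := rfl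

theorem coe_matS_inv :
    (((matS R)⁻¹ : SpecialLinearGroup (Fin 2) R) : Matrix (Fin 2) (Fin 2) R) = !![0, 1; -1, 0] := by
  simp [coe_inv, adjugate_fin_two]

theorem coe_matT_pow (n : ℕ) :
    ((matT R ^ n : SpecialLinearGroup (Fin 2) R) : Matrix (Fin 2) (Fin 2) R) =
      !![1, (n : R); 0, 1] := by
  induction n with
  | zero => simp [one_fin_two]
  | succ n ih => rw [pow_succ, coe_mul, ih]; simp [add_comm]

/-- Over a prime field, `SL₂` is generated by `S` and `T`. -/
theorem closure_matS_matT (p : ℕ) [Fact p.Prime] :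
    Subgroup.closure {matS (ZMod p), matT (ZMod p)} = ⊤ := by
  set H := Subgroup.closure {matS (ZMod p), matT (ZMod p)}
  have hS : matS (ZMod p) ∈ H := Subgroup.subset_closure (by simp)
  have hT : matT (ZMod p) ∈ H := Subgroup.subset_closure (by simp)
  have key (M : SpecialLinearGroup (Fin 2) (ZMod p)) (hM : M 1 0 ≠ 0) : M ∈ H := by
    have hdet := M.det_coe
    rw [det_fin_two] at hdet
    have hM' : M = matT _ ^ ((M 0 0 - 1) / M 1 0).val *
        (matS _ * matT _ ^ (-M 1 0).val * (matS _)⁻¹) *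
        matT _ ^ ((M 1 1 - 1) / M 1 0).val := by
      apply Subtype.ext
      rw [coe_mul, coe_mul, coe_mul, coe_mul, coe_matT_pow, coe_matT_pow, coe_matT_pow,
        coe_matS_inv, coe_matS]
      ext i j
      fin_cases i <;> fin_cases j <;>
        simp <;>
        field_simp <;> first | ring1 | linear_combination -hdet
    rw [hM']
    exact H.mul_mem (H.mul_mem (H.pow_mem hT _)
      (H.mul_mem (H.mul_mem hS (H.pow_mem hT _)) (H.inv_mem hS))) (H.pow_mem hT _)
  refine eq_top_iff.2 fun M _ => ?_
  by_cases h : M 1 0 = 0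
  · have hdet := M.det_coe
    rw [det_fin_two, h] at hdet
    refine (H.mul_mem_cancel_left hS).1 (key _ fun h0 => ?_)
    have h0' : M 0 0 = 0 := by simpa [coe_mul, Matrix.mul_apply] using h0
    simp [h0'] at hdet
  · exact key M h

end Generation

/-- The involution of `ℙ¹(𝔽₁₁)` exchanging `∞` with `0`, and each nonzero square `t` with
`c * t`, where `c` is a nonsquare. -/
def antipode (c : ZMod 11) (p : OnePoint (ZMod 11)) : OnePoint (ZMod 11) :=
  p.elim (0 : ZMod 11) fun t =>
    if t = 0 then ∞ else if t ^ 5 = 1 then ↑(c * t) else ↑(c ^ 9 * t)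

/-- The conjugate of `antipode c` by the translation `t ↦ t + i`. -/
def shiftedAntipode (c i : ZMod 11) (p : OnePoint (ZMod 11)) : OnePoint (ZMod 11) :=
  (antipode c (p.map (· - i))).map (· + i)

/-- A partial map of `ℙ¹(𝔽₁₁)` attached to each of the 24 points: a translate of `antipode 6` or of
`antipode 2` on the two nontrivial orbits, the identity and the empty map on the fixed points. -/
def matching (k : Fin 24) (p : OnePoint (ZMod 11)) : Option (OnePoint (ZMod 11)) :=
  let l : List (Fin 24) := [15, 7, 14, 5, 10, 20, 17, 11, 22, 21, 19]
  let m : List (Fin 24) := [3, 6, 12, 1, 2, 4, 8, 16, 9, 18, 13]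
  if k = 0 then Option.some p
  else if k = 23 then Option.none
  else if k ∈ l then Option.some (shiftedAntipode 6 (l.idxOf k) p)
  else Option.some (shiftedAntipode 2 (m.idxOf k) p)

theorem matching_injective : Function.Injective matching := by
  decide +kernel

/-- The diagonal matrix with entries `5` and `5⁻¹ = 9`. -/
def diagFive : SL211 := ⟨!![5, 0; 0, 9], by decide⟩

@[simp]
theorem coe_diagFive : (diagFive : Matrix (Fin 2) (Fin 2) (ZMod 11)) = !![5, 0; 0, 9] := rfl

/-- The matrix `M` and the permutation `g` act compatibly on the maps `matching k`. -/
def Compatible (M : SL211) (g : Equiv.Perm (Fin 24)) : Prop :=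
  ∀ k p, matching (g k) (toGL M • p) = (matching k p).map (toGL M • ·)

namespace Compatible

variable {M N : SL211} {g h : Equiv.Perm (Fin 24)}

theorem one : Compatible 1 1 := fun k p => by simp

theorem mul (hM : Compatible M g) (hN : Compatible N h) : Compatible (M * N) (g * h) :=
  fun k p => by
    simp only [map_mul, mul_smul, Equiv.Perm.mul_apply, hM _ _, hN _ _, Option.map_map]
    rfl

theorem inv (hM : Compatible M g) : Compatible M⁻¹ g⁻¹ := fun k p => by
  have := congrArg (Option.map ((toGL M)⁻¹ • ·)) (hM (g⁻¹ k) ((toGL M)⁻¹ • p))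
  simpa [Option.map_map, Function.comp_def] using this.symm

theorem perm_unique (hg : Compatible M g) (hh : Compatible M h) : g = h := by
  ext1 k
  refine matching_injective (funext fun p => ?_)
  rw [← smul_inv_smul (toGL M) p, hg, hh]

/-- It suffices to check compatibility on an explicit formula for the action of the matrix. -/
theorem of_formula {f : OnePoint (ZMod 11) → OnePoint (ZMod 11)} (hf : ∀ p, toGL M • p = f p)
    (h : ∀ k p, matching (g k) (f p) = (matching k p).map f) : Compatible M g := fun k p => by
  simpa only [hf] using h k p

theorem toGL_smul_infty (M : SL211) :
    toGL M • (∞ : OnePoint (ZMod 11)) = if M 1 0 = 0 then ∞ else ↑(M 0 0 / M 1 0) :=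
  smul_infty_eq_ite _

theorem toGL_smul_coe (M : SL211) (t : ZMod 11) :
    toGL M • (t : OnePoint (ZMod 11)) = if M 1 0 * t + M 1 1 = 0 then ∞ else
      ↑((M 0 0 * t + M 0 1) / (M 1 0 * t + M 1 1)) :=
  smul_some_eq_ite

theorem matT_α : Compatible (matT _) α := by
  refine of_formula (f := OnePoint.map (· + 1)) (fun p => ?_) (by decide +kernel)
  cases p with
  | infty => simp [toGL_smul_infty]
  | coe t => simp [toGL_smul_coe]

theorem diag_β : Compatible diagFive β := by
  refine of_formula (f := OnePoint.map (3 * ·)) (fun p => ?_) (by decide +kernel)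
  cases p with
  | infty => simp [toGL_smul_infty]
  | coe t =>
    have h9 : (9 : ZMod 11) ≠ 0 := by decide
    have h5 : 5 * t / 9 = 3 * t := by
      rw [div_eq_iff h9]
      linear_combination (-2 * t) * (by decide : (11 : ZMod 11) = 0)
    simp [toGL_smul_coe, h9, h5]

theorem matS_γ : Compatible (matS _) γ := by
  refine of_formula (f := fun p => p.elim ((0 : ZMod 11) : OnePoint (ZMod 11)) fun t =>
    if t = 0 then ∞ else ((-t ^ 9 : ZMod 11) : OnePoint (ZMod 11))) (fun p => ?_)
    (by decide +kernel)
  cases p with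
  | infty => simp [toGL_smul_infty]
  | coe t =>
    have h (ht : t ≠ 0) : -1 / t = -t ^ 9 := by
      have : t ^ 10 = 1 := ZMod.pow_card_sub_one_eq_one ht
      rw [div_eq_iff ht]
      linear_combination this
    by_cases ht : t = 0
    · simp [toGL_smul_coe, ht]
    · simp [toGL_smul_coe, ht, h]

end Compatible

theorem exists_compatible_matrix {g : Equiv.Perm (Fin 24)}
    (hg : g ∈ Subgroup.closure {α, β, γ}) : ∃ M, Compatible M g := by
  induction hg using Subgroup.closure_induction with
  | mem g hg =>
    obtain rfl | rfl | rfl := hg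
    exacts [⟨_, .matT_α⟩, ⟨_, .diag_β⟩, ⟨_, .matS_γ⟩]
  | one => exact ⟨_, .one⟩
  | mul _ _ _ _ hx hy => exact hx.elim fun _ hM => hy.elim fun _ hN => ⟨_, hM.mul hN⟩
  | inv _ _ hx => exact hx.elim fun _ hM => ⟨_, hM.inv⟩

theorem exists_compatible_perm (M : SL211) :
    ∃ g : Subgroup.closure {α, β, γ}, Compatible M g := by
  have hM : M ∈ Subgroup.closure {matS (ZMod 11), matT (ZMod 11)} := by
    rw [closure_matS_matT]; trivial
  induction hM using Subgroup.closure_induction with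
  | mem M hM =>
    obtain rfl | rfl := hM
    · exact ⟨⟨γ, Subgroup.subset_closure (by simp)⟩, .matS_γ⟩
    · exact ⟨⟨α, Subgroup.subset_closure (by simp)⟩, .matT_α⟩
  | one => exact ⟨1, .one⟩
  | mul _ _ _ _ hx hy => exact hx.elim fun g hg => hy.elim fun h hh => ⟨g * h, hg.mul hh⟩
  | inv _ _ hx => exact hx.elim fun g hg => ⟨g⁻¹, hg.inv⟩

/-- The homomorphism sending a matrix to the unique compatible permutation. -/
noncomputable def toClosure : SL211 →* Subgroup.closure {α, β, γ} :=
  MonoidHom.mk' (fun M => (exists_compatible_perm M).choose) fun M N =>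
    Subtype.ext <| (exists_compatible_perm (M * N)).choose_spec.perm_unique <|
      (exists_compatible_perm M).choose_spec.mul (exists_compatible_perm N).choose_spec

theorem compatible_toClosure (M : SL211) : Compatible M (toClosure M) :=
  (exists_compatible_perm M).choose_spec

theorem toClosure_surjective : Function.Surjective toClosure := fun g => by
  obtain ⟨M, hM⟩ := exists_compatible_matrix g.2
  exact ⟨M, Subtype.ext <| (compatible_toClosure M).perm_unique hM⟩

theorem toGL_smul_of_mem_center {M : SL211} (hM : M ∈ Subgroup.center SL211)
    (p : OnePoint (ZMod 11)) : toGL M • p = p := by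
  apply (equivProjectivization (ZMod 11)).injective
  rw [equivProjectivization_smul]
  rw [← Projectivization.SL_mulAction_ker] at hM
  exact DFunLike.congr_fun hM (equivProjectivization _ p)

theorem center_le_ker : Subgroup.center SL211 ≤ toClosure.ker := fun M hM =>
  Subtype.ext <| (compatible_toClosure M).perm_unique fun k p => by
    simp [toGL_smul_of_mem_center hM]

theorem α_ne_one : α ≠ 1 := by decide

instance : IsSimpleGroup (SL211 ⧸ Subgroup.center SL211) :=
  ProjectiveSpecialLinearGroup.rank_two_simple (by simp)

theorem _root_.MonoidHom.injective_of_surjective_of_isSimpleGroup {G H : Type*} [Group G] [Group H]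
    [IsSimpleGroup G] [Nontrivial H] {f : G →* H} (hf : Function.Surjective f) :
    Function.Injective f := by
  refine (MonoidHom.ker_eq_bot_iff f).1
    ((MonoidHom.normal_ker f).eq_bot_or_eq_top.resolve_right fun htop => ?_)
  obtain ⟨y, hy⟩ := exists_ne (1 : H)
  obtain ⟨x, rfl⟩ := hf y
  exact hy (MonoidHom.mem_ker.1 (htop ▸ Subgroup.mem_top x))

instance : Nontrivial (Subgroup.closure {α, β, γ}) :=
  (Subgroup.nontrivial_iff_exists_ne_one _).2
    ⟨α, Subgroup.subset_closure (Set.mem_insert _ _), α_ne_one⟩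

theorem lift_toClosure_bijective :
    Function.Bijective (QuotientGroup.lift (Subgroup.center SL211) toClosure center_le_ker) :=
  have hsurj := QuotientGroup.lift_surjective_of_surjective _ _ toClosure_surjective center_le_ker
  ⟨MonoidHom.injective_of_surjective_of_isSimpleGroup hsurj, hsurj⟩

end PSL211

/-- The subgroup generated by `α`, `β`, `γ` is isomorphic to
`PSL₂(𝔽₁₁) = SL₂(𝔽₁₁)/{±1}`, the simple group of order 660. -/
theorem closure_isomorphic_PSL2_11 :
    Nonempty ((Subgroup.closure {α, β, γ} : Subgroup (Equiv.Perm (Fin 24))) ≃*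
      SL211 ⧸ Subgroup.center SL211) := by
  exact ⟨(MulEquiv.ofBijective _ PSL211.lift_toClosure_bijective).symm⟩
end
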